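/- Let ρ, v, S : ℝ × ℝ → ℝ be continuously differentiable with ρ(x,t) > 0 for all (x,t). If ρ and v satisfy the continuity equation ∂_t ρ + ∂_x(ρ v) = 0 and the velocity relaxation equation ∂_t v = S/ρ at every point (the one-dimensional debris model with λ = 1), then the conservative balance law ∂_t(ρ² v) + ∂_x(ρ² v²) = ρ S holds at every point. -/

import Mathlib

/-- Partial derivative in time of a function of `(x, t)`. -/
noncomputable def pt (f : ℝ × ℝ → ℝ) (p : ℝ × ℝ) : ℝ :=
  deriv (fun t => f (p.1, t)) p.2

/-- Partial derivative in space of a function of `(x, t)`. -/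
noncomputable def px (f : ℝ × ℝ → ℝ) (p : ℝ × ℝ) : ℝ :=
  deriv (fun x => f (x, p.2)) p.1

theorem hasDerivAt_pt {f : ℝ × ℝ → ℝ} (hf : Differentiable ℝ f) (p : ℝ × ℝ) :
    HasDerivAt (fun t => f (p.1, t)) (pt f p) p.2 := by
  have h : Differentiable ℝ fun t : ℝ => f (p.1, t) := by fun_prop
  exact (h p.2).hasDerivAt

theorem hasDerivAt_px {f : ℝ × ℝ → ℝ} (hf : Differentiable ℝ f) (p : ℝ × ℝ) :
    HasDerivAt (fun x => f (x, p.2)) (px f p) p.1 := by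
  have h : Differentiable ℝ fun x : ℝ => f (x, p.2) := by fun_prop
  exact (h p.1).hasDerivAt

/-- Conservative form of the 1D debris model with `λ = 1`: if
`∂_t ρ + ∂_x(ρ v) = 0` and `∂_t v = S/ρ`, with `ρ > 0`, then
`∂_t(ρ² v) + ∂_x(ρ² v²) = ρ S`. -/
theorem stmt_10 (ρ v S : ℝ × ℝ → ℝ)
    (hρ : ContDiff ℝ 1 ρ) (hv : ContDiff ℝ 1 v) (hS : ContDiff ℝ 1 S)
    (hρpos : ∀ p : ℝ × ℝ, 0 < ρ p)
    (hcont : ∀ p : ℝ × ℝ, pt ρ p + px (fun q => ρ q * v q) p = 0)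
    (hrelax : ∀ p : ℝ × ℝ, pt v p = S p / ρ p) :
    ∀ p : ℝ × ℝ,
      pt (fun q => ρ q ^ 2 * v q) p + px (fun q => ρ q ^ 2 * v q ^ 2) p
        = ρ p * S p := by
  intro p
  have dρ : Differentiable ℝ ρ := hρ.differentiable one_ne_zero
  have dv : Differentiable ℝ v := hv.differentiable one_ne_zero
  have ht : pt (fun q => ρ q ^ 2 * v q) p
      = 2 * ρ p * pt ρ p * v p + ρ p ^ 2 * pt v p := by
    have h := (((hasDerivAt_pt dρ p).fun_pow 2).fun_mul (hasDerivAt_pt dv p)).deriv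
    simpa using (show pt (fun q => ρ q ^ 2 * v q) p = _ from h)
  have hx : px (fun q => ρ q ^ 2 * v q ^ 2) p
      = 2 * (ρ p * v p) * px (fun q => ρ q * v q) p := by
    simpa [px, mul_pow] using ((hasDerivAt_px (dρ.fun_mul dv) p).fun_pow 2).deriv
  have hS' : ρ p * pt v p = S p := by
    rw [hrelax p, mul_div_cancel₀ _ (hρpos p).ne']
  rw [ht, hx]
  linear_combination 2 * (ρ p * v p) * hcont p + ρ p * hS'
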